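/- Let p be a prime and r ≥ 1 an integer. Let G be a finite group and I a normal subgroup of G such that p does not divide |I| and the quotient G/I is cyclic of order d; fix g ∈ G whose image generates G/I. Let U ∈ GL_r(Z_p) satisfy det(U^d − 1) ≠ 0, and let M := Z_p^r/(U^d − 1)Z_p^r be endowed with the G-action in which I acts trivially and g acts by m + (U^d − 1)Z_p^r ↦ U·m + (U^d − 1)Z_p^r (this is a well-defined G-action factoring through G/I, since U^d acts trivially on M). Then M is a cohomologically trivial G-module: for every subgroup H ≤ G and every integer n ≥ 1 the group cohomology H^n(H, M) vanishes. -/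

import Mathlib

open CategoryTheory

/-- If the identity is a trace, then every cocycle of positive degree is a coboundary. -/
theorem aux_d_of_trace {k G : Type} [CommRing k] [Group G] [Fintype G] (A : Rep.{0} k G)
    (f : A →ₗ[k] A) (hf : ∀ x, ∑ t : G, A.ρ t⁻¹ (f (A.ρ t x)) = x) (n : ℕ)
    (φ : (Fin (n + 1) → G) → A) (hφ : inhomogeneousCochains.d A (n + 1) φ = 0) :
    ∃ ψ : (Fin n → G) → A, inhomogeneousCochains.d A n ψ = φ := by
  refine ⟨fun g => ∑ t : G, A.ρ t⁻¹ (f (φ (Fin.cons t g))), ?_⟩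
  funext g
  have h1 : ∀ t : G, A.ρ t (φ g) - φ (Fin.cons (t * g 0) (fun i => g i.succ))
      - ∑ j : Fin (n + 1), (-1 : k) ^ ((j : ℕ) + 1) •
        φ (Fin.cons t (Fin.contractNth j (· * ·) g)) = 0 := by
    intro t
    have := congrFun hφ (Fin.cons t g)
    rw [inhomogeneousCochains.d_hom_apply] at this
    rw [Fin.sum_univ_succ] at this
    have e0 : Fin.contractNth (0 : Fin (n + 2)) (· * ·) (Fin.cons t g : Fin (n + 2) → G)
        = Fin.cons (t * g 0) (fun i => g i.succ) := by
      funext i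
      refine Fin.cases ?_ (fun i => ?_) i
      · simp [Fin.contractNth]
      · simp [Fin.contractNth]
    have e1 : ∀ j : Fin (n + 1),
        Fin.contractNth j.succ (· * ·) (Fin.cons t g : Fin (n + 2) → G)
        = Fin.cons t (Fin.contractNth j (· * ·) g) := by
      intro j
      funext i
      refine Fin.cases ?_ (fun i => ?_) i
      · simp [Fin.contractNth]
      · simp [Fin.contractNth]
    simp only [e0, e1, Fin.cons_zero, Fin.cons_succ, Fin.val_zero, Fin.val_succ] at this
    rw [Pi.zero_apply] at this
    rw [← this]
    simp only [pow_succ _ (_ + 1), mul_neg, mul_one, neg_smul, Finset.sum_neg_distrib]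
    simp
    abel
  have h2 : ∑ t : G, A.ρ t⁻¹ (f (A.ρ t (φ g) - φ (Fin.cons (t * g 0) (fun i => g i.succ))
      - ∑ j : Fin (n + 1), (-1 : k) ^ ((j : ℕ) + 1) •
        φ (Fin.cons t (Fin.contractNth j (· * ·) g)))) = 0 := by
    simp [h1]
  simp only [map_sub, Finset.sum_sub_distrib, hf, map_sum, map_smul] at h2
  rw [inhomogeneousCochains.d_hom_apply]
  have h3 : ∑ t : G, A.ρ t⁻¹ (f (φ (Fin.cons (t * g 0) (fun i => g i.succ))))
      = A.ρ (g 0) (∑ t : G, A.ρ t⁻¹ (f (φ (Fin.cons t (fun i => g i.succ))))) := by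
    rw [map_sum, ← Equiv.sum_comp (Equiv.mulRight (g 0))
      (fun t => A.ρ (g 0) (A.ρ t⁻¹ (f (φ (Fin.cons t (fun i => g i.succ))))))]
    refine Finset.sum_congr rfl fun t _ => ?_
    rw [← Module.End.mul_apply (A.ρ (g 0)), ← map_mul]
    simp
  rw [h3, Finset.sum_comm] at h2
  simp only [Finset.smul_sum]
  rw [sub_sub, sub_eq_zero] at h2
  exact h2.symm

theorem aux_subsingleton_of_trace {k G : Type} [CommRing k] [Group G] [Fintype G] (A : Rep.{0} k G)
    (f : A →ₗ[k] A) (hf : ∀ x, ∑ t : G, A.ρ t⁻¹ (f (A.ρ t x)) = x) (n : ℕ) :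
    Limits.IsZero (groupCohomology A (n + 1)) := by
  have : (groupCohomology.inhomogeneousCochains A).ExactAt (n + 1) := by
    rw [HomologicalComplex.exactAt_iff' _ n (n + 1) (n + 2) (by simp) (by simp)]
    rw [ShortComplex.moduleCat_exact_iff]
    intro φ hφ
    have e1 := groupCohomology.inhomogeneousCochains.d_def A (n + 1)
    have e0 := groupCohomology.inhomogeneousCochains.d_def A n
    obtain ⟨ψ, hψ⟩ := aux_d_of_trace A f hf n φ (by
      rw [← e1]; exact hφ)
    refine ⟨ψ, ?_⟩
    rw [← hψ, ← e0]; rfl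
  exact (HomologicalComplex.exactAt_iff_isZero_homology _ _).1 this

theorem aux_shift {k G : Type} [CommRing k] [Group G] {X Y : Type} [AddCommGroup X] [AddCommGroup Y]
    [Module k X] [Module k Y] (σ : Representation k G X) (τ : Representation k G Y)
    (ψ : X →ₗ[k] X) (φ : X →ₗ[k] Y) (hψ : ∀ g x, ψ (σ g x) = σ g (ψ x))
    (hφ : ∀ g x, φ (σ g x) = τ g (φ x))
    (hinj : Function.Injective ψ) (hsurj : Function.Surjective φ)
    (hex : ∀ x, φ x = 0 ↔ ∃ y, ψ y = x)
    (h0 : ∀ n, Limits.IsZero (groupCohomology (Rep.of σ) (n + 1))) (n : ℕ) :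
    Limits.IsZero (groupCohomology (Rep.of τ) (n + 1)) := by
  let S : ShortComplex (Rep.{0} k G) :=
    { X₁ := Rep.of σ, X₂ := Rep.of σ, X₃ := Rep.of τ
      f := Rep.ofHom ⟨ψ, fun g => by ext x; exact hψ g x⟩
      g := Rep.ofHom ⟨φ, fun g => by ext x; exact hφ g x⟩
      zero := by ext x; exact (hex _).2 ⟨x, rfl⟩ }
  have hS : S.ShortExact :=
    { exact := (forget₂ (Rep.{0} k G) (ModuleCat k)).reflects_exact_of_faithful _ <|
        (ShortComplex.moduleCat_exact_iff _).2 fun x hx => (hex x).1 hx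
      mono_f := (Rep.mono_iff_injective _).2 hinj
      epi_g := (Rep.epi_iff_surjective _).2 hsurj }
  exact (groupCohomology.mapShortComplex₃_exact hS (i := n + 1) rfl).isZero_of_both_zeros
    ((h0 n).eq_of_src _ _) ((h0 (n + 1)).eq_of_tgt _ _)

/-- A weight function on `G ⧸ I` whose sum over every `H`-orbit (with multiplicity) is `1`. -/
theorem aux_weight {R : Type} [CommRing R] {G : Type} [Group G] [Finite G] (I : Subgroup G)
    (hI : IsUnit ((Nat.card I : ℕ) : R)) (H : Subgroup G) [Fintype H] :
    ∃ c : G ⧸ I → R, ∀ x, ∑ h : H, c ((h : G) • x) = 1 := by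
  classical
  have := Fintype.ofFinite G
  obtain ⟨u, hu⟩ := hI
  let c0 : G ⧸ I → R := fun x => if x = QuotientGroup.mk 1 then (↑u⁻¹ : R) else 0
  have key : ∀ x : G ⧸ I, ∑ t : G, c0 (t • x) = 1 := by
    intro x
    obtain ⟨a, rfl⟩ := QuotientGroup.mk_surjective x
    rw [← Equiv.sum_comp (Equiv.mulRight a⁻¹)]
    have : ∀ t : G, c0 ((Equiv.mulRight a⁻¹ t) • (QuotientGroup.mk a : G ⧸ I))
        = if t ∈ I then (↑u⁻¹ : R) else 0 := by
      intro t
      have : (Equiv.mulRight a⁻¹ t) • (QuotientGroup.mk a : G ⧸ I) = QuotientGroup.mk t := by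
        rw [MulAction.Quotient.smul_mk]; simp
      rw [this]
      simp only [c0]
      congr 1
      rw [eq_comm, QuotientGroup.eq]; simp
    rw [Finset.sum_congr rfl fun t _ => this t, ← Finset.sum_filter, Finset.sum_const,
      nsmul_eq_mul]
    have hc : (Finset.univ.filter (· ∈ I)).card = Nat.card I := by
      rw [Nat.card_eq_fintype_card, Fintype.card_subtype]
    rw [hc, ← hu]; simp
  obtain ⟨S, hS, -⟩ := H.exists_isComplement_left 1
  have := Fintype.ofFinite S
  refine ⟨fun y => ∑ s : S, c0 ((s : G) • y), fun x => ?_⟩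
  rw [← key x, Finset.sum_comm, ← Fintype.sum_prod_type']
  refine Fintype.sum_bijective _ hS _ _ fun y => ?_
  rw [smul_smul]

theorem aux_main {p r d : ℕ} [Fact p.Prime]
    {G : Type} [Group G] [Finite G]
    (I : Subgroup G) [I.Normal] (hpI : ¬ p ∣ Nat.card I)
    (hd : Nat.card (G ⧸ I) = d)
    (g : G) (hgen : Subgroup.zpowers (QuotientGroup.mk g : G ⧸ I) = ⊤)
    (U : Matrix (Fin r) (Fin r) ℤ_[p])
    (hU : (U ^ d - 1).det ≠ 0)
    (ρ : Representation ℤ G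
      ((Fin r → ℤ_[p]) ⧸ LinearMap.range (U ^ d - 1).mulVecLin))
    (hρI : ∀ i ∈ I, ρ i = LinearMap.id)
    (hρg : ∀ t : Fin r → ℤ_[p],
      ρ g (Submodule.Quotient.mk t) = Submodule.Quotient.mk (U.mulVec t))
    (H : Subgroup G) (n : ℕ) :
    Limits.IsZero (groupCohomology (Rep.of (ρ.comp H.subtype)) (n + 1)) := by
  classical
  have := Fintype.ofFinite H
  have := Fintype.ofFinite (G ⧸ I)
  have hunit : IsUnit ((Nat.card I : ℕ) : ℤ_[p]) := by
    rw [PadicInt.isUnit_iff]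
    rw [PadicInt.norm_natCast_eq_one_iff]
    exact (Nat.Prime.coprime_iff_not_dvd Fact.out).2 hpI
  obtain ⟨c, hc⟩ := aux_weight (R := ℤ_[p]) I hunit H
  -- the induced module
  let N : Type := G ⧸ I → (Fin r → ℤ_[p])
  let q : G ⧸ I := QuotientGroup.mk g
  let σ : Representation ℤ H N :=
    { toFun := fun h =>
        { toFun := fun F x => F ((h : G)⁻¹ • x)
          map_add' := fun _ _ => rfl
          map_smul' := fun _ _ => rfl }
      map_one' := by ext F; simp
      map_mul' := fun a b => by
        ext F x
        simp [mul_smul] }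
  have hσ : ∀ (h : H) (F : N) (x : G ⧸ I), σ h F x = F ((h : G)⁻¹ • x) := fun _ _ _ => rfl
  let f : N →ₗ[ℤ] N :=
    { toFun := fun F x => c x • F x
      map_add' := fun _ _ => by funext x; exact smul_add _ _ _
      map_smul' := fun m F => by funext x; exact smul_comm (c x) m (F x) }
  have hf : ∀ x : N, ∑ t : H, σ t⁻¹ (f (σ t x)) = x := by
    intro F
    funext x
    rw [Finset.sum_apply]
    have : ∀ t : H, σ t⁻¹ (f (σ t F)) x = c ((t : G) • x) • F x := by
      intro t
      rw [hσ]
      change c _ • F _ = _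
      simp
    simp only [this]
    rw [← Finset.sum_smul, hc, one_smul]
  have hN : ∀ n, Limits.IsZero (groupCohomology (Rep.of σ) (n + 1)) :=
    fun n => aux_subsingleton_of_trace (Rep.of σ) f hf n
  -- the two maps
  let ψ : N →ₗ[ℤ] N :=
    { toFun := fun F x => U.mulVec (F x) - F (x * q⁻¹)
      map_add' := fun F F' => by
        funext x
        change U.mulVec (F x + F' x) - (F _ + F' _) = (_ - _) + (_ - _)
        rw [Matrix.mulVec_add]; abel
      map_smul' := fun m F => by
        funext x
        change U.mulVec (m • F x) - m • F _ = m • (_ - _)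
        rw [Matrix.mulVec_smul, smul_sub] }
  have hψ : ∀ F x, ψ F x = U.mulVec (F x) - F (x * q⁻¹) := fun _ _ => rfl
  let φ : N →ₗ[ℤ] ((Fin r → ℤ_[p]) ⧸ LinearMap.range (U ^ d - 1).mulVecLin) :=
    { toFun := fun F => ∑ x : G ⧸ I, ρ x.out (Submodule.Quotient.mk (F x))
      map_add' := fun F F' => by
        rw [← Finset.sum_add_distrib]
        refine Finset.sum_congr rfl fun x _ => ?_
        rw [← map_add]; rfl
      map_smul' := fun m F => by
        rw [Finset.smul_sum]
        refine Finset.sum_congr rfl fun x _ => ?_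
        rw [RingHom.id_apply, ← map_smul]; rfl }
  have hφ : ∀ F, φ F = ∑ x : G ⧸ I, ρ x.out (Submodule.Quotient.mk (F x)) := fun _ => rfl
  have hout : ∀ (a : G) (x : G ⧸ I), QuotientGroup.mk a = x → ρ x.out = ρ a := by
    intro a x hx
    have h1 : a⁻¹ * x.out ∈ I := by
      rw [← QuotientGroup.eq, hx]; simp
    have h2 : x.out = a * (a⁻¹ * x.out) := by group
    rw [h2, map_mul, hρI _ h1]; rfl
  let δ : G ⧸ I → (Fin r → ℤ_[p]) → N := fun x a => Pi.single x a
  have hδadd : ∀ x a b, δ x (a - b) = δ x a - δ x b := fun x a b =>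
    map_sub (AddMonoidHom.single (fun _ : G ⧸ I => (Fin r → ℤ_[p])) x) a b
  have hδψ : ∀ x a, ψ (δ x a) = δ x (U.mulVec a) - δ (x * q) a := by
    intro x a
    funext y
    rw [hψ]
    have e : (δ x (U.mulVec a) - δ (x * q) a) y = δ x (U.mulVec a) y - δ (x * q) a y := rfl
    rw [e]
    simp only [δ, Pi.single_apply, mul_inv_eq_iff_eq_mul]
    congr 1
    split_ifs
    · rfl
    · exact Matrix.mulVec_zero U
  let R := LinearMap.range ψ
  have hδR : ∀ (k : ℕ) a, δ 1 ((U ^ k).mulVec a) - δ (q ^ k) a ∈ R := by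
    intro k
    induction k with
    | zero => intro a; simp
    | succ k ih =>
      intro a
      have e1 := ih (U.mulVec a)
      have e2 : ψ (δ (q ^ k) a) ∈ R := ⟨_, rfl⟩
      rw [hδψ] at e2
      have := R.add_mem e1 e2
      rw [pow_succ, pow_succ, ← Matrix.mulVec_mulVec]
      simpa using this
  have hqd : q ^ d = 1 := by rw [← hd]; exact pow_card_eq_one'
  have hφδ : ∀ a, φ (δ 1 a) = Submodule.Quotient.mk a := by
    intro a
    rw [hφ, Finset.sum_eq_single 1]
    · rw [hout 1 1 rfl]; simp [δ]
    · intro x _ hx; simp [δ, hx]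
    · simp
  have hφψ : ∀ F, φ (ψ F) = 0 := by
    intro F
    rw [hφ]
    simp only [hψ, Submodule.Quotient.mk_sub, map_sub, Finset.sum_sub_distrib]
    rw [sub_eq_zero, ← Equiv.sum_comp (Equiv.mulRight q)
      (fun x => ρ x.out (Submodule.Quotient.mk (F (x * q⁻¹))))]
    refine Finset.sum_congr rfl fun x _ => ?_
    rw [← hρg, hout (x.out * g) (Equiv.mulRight q x) (by simp [q]), map_mul]
    simp
  refine aux_shift σ (ρ.comp H.subtype) ψ φ ?_ ?_ ?_ ?_ ?_ hN n
  · intro h F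
    funext x
    rw [hψ, hσ, hσ, hσ, hψ]
    congr 2
    obtain ⟨a, rfl⟩ := QuotientGroup.mk_surjective x
    change (QuotientGroup.mk ((h : G)⁻¹ * (a * g⁻¹)) : G ⧸ I)
      = QuotientGroup.mk (((h : G)⁻¹ * a) * g⁻¹)
    rw [mul_assoc]
  · intro h F
    rw [hφ, hφ, map_sum, ← Equiv.sum_comp (MulAction.toPerm (h : G))]
    refine Finset.sum_congr rfl fun x _ => ?_
    rw [hσ, hout ((h : G) * x.out) (MulAction.toPerm (h : G) x) (by
      rw [MulAction.toPerm_apply, ← smul_eq_mul, ← MulAction.Quotient.smul_mk]; simp), map_mul]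
    simp
  · rw [injective_iff_map_eq_zero]
    intro F hF
    have h1 : ∀ x, U.mulVec (F x) = F (x * q⁻¹) := fun x => by
      have := congrFun hF x
      rw [hψ] at this
      exact sub_eq_zero.1 this
    have h2 : ∀ (k : ℕ) x, (U ^ k).mulVec (F x) = F (x * (q ^ k)⁻¹) := by
      intro k
      induction k with
      | zero => intro x; simp
      | succ k ih =>
        intro x
        rw [pow_succ, ← Matrix.mulVec_mulVec, h1, ih, pow_succ]
        simp [mul_assoc]
    funext x
    have h3 := h2 d x
    rw [hqd] at h3
    refine Matrix.eq_zero_of_mulVec_eq_zero hU ?_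
    rw [Matrix.sub_mulVec, h3]; simp
  · intro y
    obtain ⟨a, rfl⟩ := Submodule.Quotient.mk_surjective _ y
    exact ⟨δ 1 a, hφδ a⟩
  · intro F
    constructor
    · intro hF
      have hk : ∀ x : G ⧸ I, ∃ k : ℕ, q ^ k = x := by
        intro x
        have : x ∈ Subgroup.zpowers q := by rw [hgen]; trivial
        rwa [← mem_powers_iff_mem_zpowers] at this
      choose k hk using hk
      have hδsum : ∀ (s : Finset (G ⧸ I)) (w : G ⧸ I → (Fin r → ℤ_[p])),
          δ 1 (∑ x ∈ s, w x) = ∑ x ∈ s, δ 1 (w x) := fun s w =>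
        map_sum (AddMonoidHom.single (fun _ : G ⧸ I => (Fin r → ℤ_[p])) 1) w s
      have hFsum : F = ∑ x, δ x (F x) := (Finset.univ_sum_single F).symm
      let b := ∑ x, (U ^ k x).mulVec (F x)
      have h1 : δ 1 b - F ∈ R := by
        have : δ 1 b - F = ∑ x, (δ 1 ((U ^ k x).mulVec (F x)) - δ (q ^ k x) (F x)) := by
          rw [Finset.sum_sub_distrib]
          simp only [hk]
          rw [← hFsum, hδsum]
        rw [this]
        exact Submodule.sum_mem _ fun x _ => hδR _ _
      have h2 : φ (δ 1 b) = 0 := by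
        obtain ⟨F', hF'⟩ := h1
        have := hφψ F'
        rw [hF', map_sub, hF, sub_zero] at this
        exact this
      rw [hφδ, Submodule.Quotient.mk_eq_zero] at h2
      obtain ⟨e, he⟩ := h2
      have h3 : δ 1 b ∈ R := by
        have := hδR d e
        rw [hqd, ← hδadd] at this
        rw [← he]
        simpa [Matrix.sub_mulVec] using this
      have := R.sub_mem h3 h1
      rw [sub_sub_cancel] at this
      exact this
    · rintro ⟨y, rfl⟩
      exact hφψ y

/-- Let `G` be a finite group, `I ◁ G` with `p ∤ |I|` and `G/I` cyclic of
order `d` generated by the image of `g`. Let `U ∈ GL_r(ℤ_p)` with `det(U^d − 1) ≠ 0` and let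
`M = ℤ_p^r/(U^d − 1)ℤ_p^r` carry the `G`-action in which `I` acts trivially and `g` acts
through `U`. Then `M` is a cohomologically trivial `G`-module: `Hⁿ(H, M) = 0` for every
subgroup `H ≤ G` and every `n ≥ 1`. -/
theorem cohomologically_trivial_of_unramified_twist
    {p r d : ℕ} [Fact p.Prime] (hr : 1 ≤ r)
    {G : Type} [Group G] [Finite G]
    (I : Subgroup G) [I.Normal] (hpI : ¬ p ∣ Nat.card I)
    (hd : Nat.card (G ⧸ I) = d)
    (g : G) (hgen : Subgroup.zpowers (QuotientGroup.mk g : G ⧸ I) = ⊤)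
    (U : Matrix.GeneralLinearGroup (Fin r) ℤ_[p])
    (hU : (((U : Matrix (Fin r) (Fin r) ℤ_[p])) ^ d - 1).det ≠ 0)
    (ρ : Representation ℤ G
      ((Fin r → ℤ_[p]) ⧸ LinearMap.range (((U : Matrix (Fin r) (Fin r) ℤ_[p])) ^ d - 1).mulVecLin))
    (hρI : ∀ i ∈ I, ρ i = LinearMap.id)
    (hρg : ∀ t : Fin r → ℤ_[p],
      ρ g (Submodule.Quotient.mk t)
        = Submodule.Quotient.mk ((U : Matrix (Fin r) (Fin r) ℤ_[p]).mulVec t)) :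
    ∀ (H : Subgroup G) (n : ℕ), 1 ≤ n →
      Subsingleton (groupCohomology (Rep.of (ρ.comp H.subtype)) n) := by
  intro H n hn
  obtain ⟨m, rfl⟩ : ∃ m, n = m + 1 := ⟨n - 1, by omega⟩
  exact ModuleCat.subsingleton_of_isZero
    (aux_main I hpI hd g hgen (U : Matrix (Fin r) (Fin r) ℤ_[p]) hU ρ hρI hρg H m)
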